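/- Let (ξ^k, Q^k), k = 1,…,n, be solutions of the martingale selection problem (V,C). Then for every convex combination Q = λ_1 Q^1 + ⋯ + λ_n Q^n with λ_k ∈ (0,1) and λ_1 + ⋯ + λ_n = 1, there exists a process ξ = (ξ_t)_{t∈I} with ξ_t ∈ L(F_t;V_t) for every t ∈ I such that (ξ, Q) is a solution of (V,C). -/

import Mathlib

open Set MeasureTheory Pointwise

namespace MSPPaper

section Defs

variable {Ω E : Type*}

/-- A finitely supported probability measure on `Ω`: finite support, strictly
positive weights on the support, total mass one. -/
structure FinProb (Ω : Type*) where
  supp : Finset Ω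
  w : Ω → ℝ
  pos : ∀ ω ∈ supp, 0 < w ω
  zero : ∀ ω ∉ supp, w ω = 0
  sum_one : ∑ ω ∈ supp, w ω = 1

/-- The measure of a set under a finitely supported probability. -/
noncomputable def FinProb.meas (Q : FinProb Ω) (A : Set Ω) : ℝ :=
  letI := Classical.decPred fun ω => ω ∈ A
  ∑ ω ∈ Q.supp.filter (fun ω => ω ∈ A), Q.w ω

/-- The level set `Σ_t^ω` of the process `ψ`. -/
def level (ψ : ℕ → Ω → E) (t : ℕ) (ω : Ω) : Set Ω :=
  {ω' | ∀ s ≤ t, ψ s ω' = ψ s ω}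

/-- The conditional expectation `E_Q[ξ | F_t](ω)`. -/
noncomputable def condExp {F : Type*} [AddCommMonoid F] [Module ℝ F]
    (ψ : ℕ → Ω → E) (t : ℕ) (Q : FinProb Ω) (ξ : Ω → F) (ω : Ω) : F :=
  letI := Classical.decPred fun ω' => ω' ∈ level ψ t ω
  (Q.meas (level ψ t ω))⁻¹ •
    ∑ ω' ∈ Q.supp.filter (fun ω' => ω' ∈ level ψ t ω), Q.w ω' • ξ ω'

variable [MeasurableSpace E]

/-- The natural filtration `F̂_t` generated by `ψ_0, …, ψ_t`. -/
def natFilt (ψ : ℕ → Ω → E) (t : ℕ) : MeasurableSpace Ω :=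
  ⨆ s ∈ Finset.range (t + 1), MeasurableSpace.comap (ψ s) inferInstance

/-- The `P`-null sets relative to `F̂_t`. -/
def nullSets (ψ : ℕ → Ω → E) (P : FinProb Ω) (t : ℕ) : Set (Set Ω) :=
  {A | ∃ A', A ⊆ A' ∧ MeasurableSet[natFilt ψ t] A' ∧ P.meas A' = 0}

/-- The completed filtration `F_t`. -/
def filt (ψ : ℕ → Ω → E) (t : ℕ) : MeasurableSpace Ω :=
  ⨅ P : FinProb Ω,
    MeasurableSpace.generateFrom ({A | MeasurableSet[natFilt ψ t] A} ∪ nullSets ψ P t)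

/-- `G`-measurability of a correspondence. -/
def CorrMeasurable {F : Type*} [TopologicalSpace F]
    (G : MeasurableSpace Ω) (U : Ω → Set F) : Prop :=
  ∀ O : Set F, IsOpen O → MeasurableSet[G] {ω | (U ω ∩ O).Nonempty}

/-- The set `L(G; U)` of `G`-measurable selections of `U`. -/
def Selections {F : Type*} [MeasurableSpace F]
    (G : MeasurableSpace Ω) (U : Ω → Set F) : Set (Ω → F) :=
  {ξ | Measurable[G] ξ ∧ ∀ ω, ξ ω ∈ U ω}

/-- The correspondence `U^♯` (taken at stage `t`). -/
def sharp {d : ℕ} (ψ : ℕ → Ω → E) (t : ℕ) (U : Ω → Set (Fin d → ℝ)) (ω : Ω) :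
    Set (Fin d → ℝ) :=
  convexHull ℝ (⋃ ω' ∈ level ψ t ω, U ω')

/-- The correspondence `U^♭` (taken at stage `t`). -/
def flat {d : ℕ} (ψ : ℕ → Ω → E) (t : ℕ) (U : Ω → Set (Fin d → ℝ)) (ω : Ω) :
    Set (Fin d → ℝ) :=
  ⋂ ω' ∈ level ψ t ω, ⋃ l ∈ Ioo (0 : ℝ) 1, (l • U ω' + (1 - l) • sharp ψ t U ω)

/-- The backward iteration defining `W`, indexed from the terminal date. -/
def Wrev {d : ℕ} (ψ : ℕ → Ω → E) (T : ℕ) (V C : ℕ → Ω → Set (Fin d → ℝ)) :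
    ℕ → Ω → Set (Fin d → ℝ)
  | 0 => V T
  | (k + 1) => fun ω =>
      V (T - (k + 1)) ω ∩
        (flat ψ (T - (k + 1)) (Wrev ψ T V C k) ω - C (T - (k + 1)) ω)

/-- The sequence `W_t`: `W_T = V_T` and `W_t = V_t ∩ (W_{t+1}^♭ − C_t)` for `t < T`. -/
def W {d : ℕ} (ψ : ℕ → Ω → E) (T : ℕ) (V C : ℕ → Ω → Set (Fin d → ℝ)) (t : ℕ) :
    Ω → Set (Fin d → ℝ) :=
  Wrev ψ T V C (T - t)

/-- The defining hypotheses of a martingale selection problem `(V, C)`: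
adapted measurable correspondences, `V_t(ω)` convex and relatively open,
`C_t(ω)` closed and convex. -/
def IsMSP {d : ℕ} (ψ : ℕ → Ω → E) (T : ℕ) (V C : ℕ → Ω → Set (Fin d → ℝ)) : Prop :=
  ∀ t ≤ T,
    CorrMeasurable (filt ψ t) (V t) ∧ CorrMeasurable (filt ψ t) (C t) ∧
    ∀ ω : Ω, Convex ℝ (V t ω) ∧ V t ω = intrinsicInterior ℝ (V t ω) ∧
      IsClosed (C t ω) ∧ Convex ℝ (C t ω)

/-- `(ξ, Q)` is a solution of the martingale selection problem `(V, C)`. -/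
def IsSolution {d : ℕ} (ψ : ℕ → Ω → E) (T : ℕ) (V C : ℕ → Ω → Set (Fin d → ℝ))
    (ξ : ℕ → Ω → (Fin d → ℝ)) (Q : FinProb Ω) : Prop :=
  (∀ t ≤ T, ξ t ∈ Selections (filt ψ t) (V t)) ∧
  (∀ t, t + 1 ≤ T → ∀ ω ∈ Q.supp, condExp ψ t Q (ξ (t + 1)) ω - ξ t ω ∈ C t ω)

/-- Solvability of the martingale selection problem: a local solution exists at
every point of `Ω`. -/
def Solvable {d : ℕ} (ψ : ℕ → Ω → E) (T : ℕ) (V C : ℕ → Ω → Set (Fin d → ℝ)) : Prop :=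
  ∀ ωb : Ω, ∃ (ξ : ℕ → Ω → (Fin d → ℝ)) (Q : FinProb Ω),
    ωb ∈ Q.supp ∧ IsSolution ψ T V C ξ Q

/-- The positive polar cone of a subset of `ℝ^d`. -/
def polar {d : ℕ} (B : Set (Fin d → ℝ)) : Set (Fin d → ℝ) :=
  {y | ∀ x ∈ B, 0 ≤ ∑ i, y i * x i}

/-- A closed convex cone (containing the origin). -/
def IsClosedConvexCone {F : Type*} [TopologicalSpace F] [AddCommMonoid F] [Module ℝ F]
    (A : Set F) : Prop :=
  IsClosed A ∧ Convex ℝ A ∧ (0 : F) ∈ A ∧ ∀ c : ℝ, 0 < c → ∀ x ∈ A, c • x ∈ A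

end Defs

section Helpers

variable {Ω E : Type*}

theorem FinProb.nonneg (Q : FinProb Ω) (ω : Ω) : 0 ≤ Q.w ω := by
  by_cases h : ω ∈ Q.supp
  · exact (Q.pos ω h).le
  · exact (Q.zero ω h).ge

theorem FinProb.mem_supp_of_ne_zero (Q : FinProb Ω) {ω : Ω} (h : Q.w ω ≠ 0) : ω ∈ Q.supp := by
  by_contra h'
  exact h (Q.zero ω h')

open Classical in
theorem FinProb.sum_filter_supp {F : Type*} [AddCommMonoid F] [Module ℝ F]
    (Q : FinProb Ω) {S : Finset Ω} (hS : Q.supp ⊆ S) (A : Set Ω) (f : Ω → F) :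
    ∑ ω ∈ Q.supp.filter (fun ω => ω ∈ A), Q.w ω • f ω =
      ∑ ω ∈ S.filter (fun ω => ω ∈ A), Q.w ω • f ω := by
  refine Finset.sum_subset (Finset.filter_subset_filter _ hS) fun ω hω hω' => ?_
  rw [Q.zero ω, zero_smul]
  intro h
  exact hω' (Finset.mem_filter.2 ⟨h, (Finset.mem_filter.1 hω).2⟩)

open Classical in
theorem FinProb.meas_eq (Q : FinProb Ω) {S : Finset Ω} (hS : Q.supp ⊆ S) (A : Set Ω) :
    Q.meas A = ∑ ω ∈ S.filter (fun ω => ω ∈ A), Q.w ω := by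
  have := Q.sum_filter_supp hS A (fun _ => (1 : ℝ))
  simp only [smul_eq_mul, mul_one] at this
  rw [← this]
  unfold FinProb.meas
  congr!

theorem FinProb.meas_nonneg (Q : FinProb Ω) (A : Set Ω) : 0 ≤ Q.meas A :=
  Finset.sum_nonneg fun ω _ => Q.nonneg ω

theorem FinProb.meas_pos (Q : FinProb Ω) {A : Set Ω} {ω : Ω} (h : ω ∈ Q.supp) (hA : ω ∈ A) :
    0 < Q.meas A := by
  classical
  rw [Q.meas_eq subset_rfl]
  exact Finset.sum_pos' (fun ω _ => Q.nonneg ω) ⟨ω, Finset.mem_filter.2 ⟨h, hA⟩, Q.pos ω h⟩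

theorem FinProb.exists_mem_of_meas_ne_zero (Q : FinProb Ω) {A : Set Ω} (h : Q.meas A ≠ 0) :
    ∃ ω ∈ Q.supp, ω ∈ A := by
  classical
  rw [Q.meas_eq subset_rfl] at h
  obtain ⟨ω, hω, -⟩ := Finset.exists_ne_zero_of_sum_ne_zero h
  exact ⟨ω, Finset.mem_filter.1 hω⟩

theorem mem_level_self (ψ : ℕ → Ω → E) (t : ℕ) (ω : Ω) : ω ∈ level ψ t ω :=
  fun _ _ => rfl

theorem level_eq_of_mem {ψ : ℕ → Ω → E} {t : ℕ} {ω ω' : Ω} (h : ω' ∈ level ψ t ω) :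
    level ψ t ω' = level ψ t ω := by
  ext x
  exact ⟨fun hx s hs => (hx s hs).trans (h s hs), fun hx s hs => (hx s hs).trans (h s hs).symm⟩

theorem level_antitone (ψ : ℕ → Ω → E) (ω : Ω) : Antitone fun t => level ψ t ω :=
  fun _ _ hst _ hx r hr => hx r (hr.trans hst)

theorem mem_level_comm {ψ : ℕ → Ω → E} {t : ℕ} {ω ω' : Ω} :
    ω' ∈ level ψ t ω ↔ ω ∈ level ψ t ω' :=
  ⟨fun h s hs => (h s hs).symm, fun h s hs => (h s hs).symm⟩

variable [MeasurableSpace E]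

theorem natFilt_le_filt (ψ : ℕ → Ω → E) (t : ℕ) : natFilt ψ t ≤ filt ψ t :=
  le_iInf fun _ _ hA => MeasurableSpace.measurableSet_generateFrom (Or.inl hA)

theorem measurableSet_level [MeasurableSingletonClass E] (ψ : ℕ → Ω → E) (t : ℕ) (ω : Ω) :
    MeasurableSet[natFilt ψ t] (level ψ t ω) := by
  have h : level ψ t ω = ⋂ s ∈ Finset.range (t + 1), ψ s ⁻¹' {ψ s ω} := by
    ext x
    simp [level]
  rw [h]
  refine Finset.measurableSet_biInter _ fun s hs => ?_
  have hle : MeasurableSpace.comap (ψ s) inferInstance ≤ natFilt ψ t :=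
    le_iSup₂ (f := fun s (_ : s ∈ Finset.range (t + 1)) =>
      MeasurableSpace.comap (ψ s) inferInstance) s hs
  exact hle _ ⟨_, measurableSet_singleton _, rfl⟩

theorem mem_iff_of_measurableSet_natFilt {ψ : ℕ → Ω → E} {t : ℕ} {ω ω' : Ω}
    (h : ω' ∈ level ψ t ω) {A : Set Ω} (hA : MeasurableSet[natFilt ψ t] A) :
    ω' ∈ A ↔ ω ∈ A := by
  let D : MeasurableSpace Ω :=
    { MeasurableSet' := fun A => ω' ∈ A ↔ ω ∈ A
      measurableSet_empty := Iff.rfl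
      measurableSet_compl := fun _ hs => not_congr hs
      measurableSet_iUnion := fun f hf => by
        simp only [mem_iUnion]
        exact exists_congr hf }
  have hD : natFilt ψ t ≤ D := by
    refine iSup₂_le fun s hs => ?_
    rintro _ ⟨B, -, rfl⟩
    change ψ s ω' ∈ B ↔ ψ s ω ∈ B
    rw [h s (Nat.lt_succ_iff.1 (Finset.mem_range.1 hs))]
  exact hD _ hA

/-- The level sets are contained in atoms of the completed filtration. -/
theorem mem_iff_of_measurableSet_filt {ψ : ℕ → Ω → E} {t : ℕ} {ω ω' : Ω}
    (h : ω' ∈ level ψ t ω) {A : Set Ω} (hA : MeasurableSet[filt ψ t] A) :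
    ω' ∈ A ↔ ω ∈ A := by
  classical
  have hc : (0 : ℝ) < (({ω, ω'} : Finset Ω).card : ℝ)⁻¹ := by
    rw [inv_pos, Nat.cast_pos, Finset.card_pos]
    exact ⟨ω, Finset.mem_insert_self _ _⟩
  let P : FinProb Ω :=
    { supp := {ω, ω'}
      w := fun x => if x ∈ ({ω, ω'} : Finset Ω) then (({ω, ω'} : Finset Ω).card : ℝ)⁻¹ else 0
      pos := fun x hx => by rwa [if_pos hx]
      zero := fun x hx => if_neg hx
      sum_one := by
        rw [Finset.sum_congr rfl fun x hx => if_pos hx, Finset.sum_const, nsmul_eq_mul,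
          mul_inv_cancel₀ (inv_pos.1 hc).ne'] }
  have hP : MeasurableSet[MeasurableSpace.generateFrom
      ({A | MeasurableSet[natFilt ψ t] A} ∪ nullSets ψ P t)] A :=
    iInf_le (fun P : FinProb Ω => MeasurableSpace.generateFrom
      ({A | MeasurableSet[natFilt ψ t] A} ∪ nullSets ψ P t)) P A hA
  clear hA
  induction A, hP using MeasurableSpace.generateFrom_induction with
  | hC B hB _ =>
    rcases hB with hB | ⟨B', hBB', -, hB'⟩
    · exact mem_iff_of_measurableSet_natFilt h hB
    · have hout : ∀ x ∈ P.supp, x ∉ B := fun x hx hxB =>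
        (P.meas_pos hx (hBB' hxB)).ne' hB'
      exact iff_of_false (hout ω' (by simp [P])) (hout ω (by simp [P]))
  | empty => exact Iff.rfl
  | compl B _ ih => exact not_congr ih
  | iUnion f _ ih =>
    simp only [mem_iUnion]
    exact exists_congr ih

theorem eq_of_measurable_filt {F : Type*} [MeasurableSpace F] [MeasurableSingletonClass F]
    {ψ : ℕ → Ω → E} {t : ℕ} {f : Ω → F} (hf : Measurable[filt ψ t] f) {ω ω' : Ω}
    (h : ω' ∈ level ψ t ω) : f ω' = f ω :=
  (mem_iff_of_measurableSet_filt h (hf (measurableSet_singleton (f ω)))).2 rfl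

theorem CorrMeasurable.closure_eq {F : Type*} [TopologicalSpace F]
    {ψ : ℕ → Ω → E} {t : ℕ} {U : Ω → Set F} (hU : CorrMeasurable (filt ψ t) U) {ω ω' : Ω}
    (h : ω' ∈ level ψ t ω) : closure (U ω') = closure (U ω) := by
  ext x
  simp only [mem_closure_iff, inter_comm _ (U _)]
  exact forall₂_congr fun O hO =>
    imp_congr_right fun _ => mem_iff_of_measurableSet_filt h (hU O hO)

theorem measurable_meas_level [MeasurableSingletonClass E] (ψ : ℕ → Ω → E) (t : ℕ)
    (Q : FinProb Ω) : Measurable[filt ψ t] fun ω => Q.meas (level ψ t ω) := by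
  classical
  let _ := filt ψ t
  have h : (fun ω => Q.meas (level ψ t ω)) =
      fun ω => ∑ x ∈ Q.supp, (level ψ t x).indicator (fun _ => Q.w x) ω := by
    ext ω
    rw [Q.meas_eq subset_rfl, Finset.sum_filter]
    refine Finset.sum_congr rfl fun x _ => ?_
    rw [indicator_apply, mem_level_comm]
  rw [h]
  exact Finset.measurable_fun_sum _ fun x _ => measurable_const.indicator
    (natFilt_le_filt ψ t _ (measurableSet_level ψ t x))

/-- Redistributing the mass of `q` inside the classes of an equivalence relation proportionally
to `p` does not change the integral of a function constant on the classes. -/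
theorem sum_smul_redistribute {F : Type*} [AddCommGroup F] [Module ℝ F] (A : Finset Ω)
    (r : Ω → Ω → Prop) [DecidableRel r] (hsymm : ∀ a b, r a b → r b a)
    (p q M m : Ω → ℝ) (f : Ω → F)
    (hM : ∀ a ∈ A, M a = ∑ b ∈ A.filter (r a), p b)
    (hm : ∀ a ∈ A, m a = ∑ b ∈ A.filter (r a), q b)
    (hMr : ∀ a b, r a b → M a = M b) (hf : ∀ a b, r a b → f a = f b)
    (hq : ∀ a ∈ A, q a ≠ 0 → M a ≠ 0) :
    ∑ a ∈ A, p a • (m a / M a) • f a = ∑ a ∈ A, q a • f a := by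
  have h1 : ∀ a ∈ A, p a • (m a / M a) • f a =
      ∑ b ∈ A, if r a b then (q b * (p a / M b)) • f b else 0 := by
    intro a ha
    rw [← Finset.sum_filter, smul_smul, hm a ha, Finset.sum_div, Finset.mul_sum, Finset.sum_smul]
    refine Finset.sum_congr rfl fun b hb => ?_
    have hr := (Finset.mem_filter.1 hb).2
    rw [hMr a b hr, hf a b hr]
    congr 1
    ring
  rw [Finset.sum_congr rfl h1, Finset.sum_comm]
  refine Finset.sum_congr rfl fun b hb => ?_
  rw [← Finset.sum_filter, ← Finset.sum_smul, ← Finset.mul_sum, ← Finset.sum_div,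
    Finset.filter_congr (fun a _ => ⟨hsymm a b, hsymm b a⟩), ← hM b hb]
  by_cases h : q b = 0
  · simp [h]
  · rw [div_self (hq b hb h), mul_one]

end Helpers

/-- Lemma 4.5: convexity of the set of solutions of the MSP. -/
theorem solution_convex_combination
    {Ω E : Type*}
    [TopologicalSpace Ω] [PolishSpace Ω] [MeasurableSpace Ω] [BorelSpace Ω]
    [MetricSpace E] [TopologicalSpace.SeparableSpace E] [MeasurableSpace E] [BorelSpace E]
    (ψ : ℕ → Ω → E) (hψ : ∀ t, Measurable (ψ t)) (hψ0 : ∃ e : E, ∀ ω, ψ 0 ω = e)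
    (d T : ℕ) (V C : ℕ → Ω → Set (Fin d → ℝ)) (hMSP : IsMSP ψ T V C)
    {n : ℕ} (l : Fin n → ℝ) (hl : ∀ k, l k ∈ Ioo (0 : ℝ) 1) (hl1 : ∑ k, l k = 1)
    (ξ : Fin n → ℕ → Ω → (Fin d → ℝ)) (Q : Fin n → FinProb Ω)
    (hsol : ∀ k, IsSolution ψ T V C (ξ k) (Q k))
    (R : FinProb Ω) (hR : ∀ ω, R.w ω = ∑ k, l k * (Q k).w ω) :
    ∃ ζ : ℕ → Ω → (Fin d → ℝ), IsSolution ψ T V C ζ R := by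
  classical
  have hne : Nonempty (Fin n) := by
    by_contra h
    rw [not_nonempty_iff] at h
    simp at hl1
  obtain ⟨k₀⟩ := hne
  set S : Finset Ω := R.supp ∪ Finset.univ.biUnion fun k => (Q k).supp
  have hRS : R.supp ⊆ S := Finset.subset_union_left
  have hQS : ∀ k, (Q k).supp ⊆ S := fun k =>
    (Finset.subset_biUnion_of_mem (fun k => (Q k).supp) (Finset.mem_univ k)).trans
      Finset.subset_union_right
  have hQR : ∀ k, (Q k).supp ⊆ R.supp := fun k ω hω => by
    refine R.mem_supp_of_ne_zero (ne_of_gt ?_)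
    rw [hR]
    exact Finset.sum_pos' (fun j _ => mul_nonneg (hl j).1.le ((Q j).nonneg ω))
      ⟨k, Finset.mem_univ k, mul_pos (hl k).1 ((Q k).pos ω hω)⟩
  have hmeas : ∀ A, R.meas A = ∑ k, l k * (Q k).meas A := fun A => by
    simp_rw [R.meas_eq hRS, fun k => (Q k).meas_eq (hQS k), hR, Finset.mul_sum]
    exact Finset.sum_comm
  set ζ : ℕ → Ω → (Fin d → ℝ) := fun t ω =>
    if R.meas (level ψ t ω) = 0 then ξ k₀ t ω
    else ∑ k, (l k * ((Q k).meas (level ψ t ω) / R.meas (level ψ t ω))) • ξ k t ω with hζ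
  have hwt0 : ∀ k A, 0 ≤ l k * ((Q k).meas A / R.meas A) := fun k A =>
    mul_nonneg (hl k).1.le (div_nonneg ((Q k).meas_nonneg A) (R.meas_nonneg A))
  have hwt1 : ∀ A, R.meas A ≠ 0 → ∑ k, l k * ((Q k).meas A / R.meas A) = 1 := fun A hA => by
    simp_rw [← mul_div_assoc]
    rw [← Finset.sum_div, ← hmeas, div_self hA]
  refine ⟨ζ, fun t ht => ⟨?_, fun ω => ?_⟩, fun t ht ω hω => ?_⟩
  · have hξ : ∀ k, Measurable[filt ψ t] (ξ k t) := fun k => ((hsol k).1 t ht).1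
    have hR' := measurable_meas_level ψ t R
    have hQ' := fun k => measurable_meas_level ψ t (Q k)
    let _ := filt ψ t
    refine Measurable.ite (hR' (measurableSet_singleton 0)) (hξ k₀) ?_
    exact Finset.measurable_fun_sum _ fun k _ =>
      (measurable_const.mul ((hQ' k).div hR')).smul (hξ k)
  · simp only [hζ]
    split_ifs with h
    · exact ((hsol k₀).1 t ht).2 ω
    · exact ((hMSP t ht).2.2 ω).1.sum_mem (fun k _ => hwt0 k _) (hwt1 _ h)
        fun k _ => ((hsol k).1 t ht).2 ω
  · have hpos : R.meas (level ψ t ω) ≠ 0 := (R.meas_pos hω (mem_level_self ψ t ω)).ne'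
    set L := level ψ t ω
    have hsub : ∀ a ∈ L, level ψ (t + 1) a ⊆ L := fun a ha =>
      (level_antitone ψ a (Nat.le_succ t)).trans (level_eq_of_mem ha).subset
    have hfilter : ∀ a ∈ S.filter (fun x => x ∈ L),
        S.filter (fun x => x ∈ level ψ (t + 1) a) =
          (S.filter (fun x => x ∈ L)).filter (fun x => x ∈ level ψ (t + 1) a) := fun a ha => by
      rw [Finset.filter_filter]
      refine Finset.filter_congr fun x _ => ?_
      exact ⟨fun h => ⟨hsub a (Finset.mem_filter.1 ha).2 h, h⟩, fun h => h.2⟩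
    have hsum : ∑ x ∈ S.filter (fun x => x ∈ L), R.w x • ζ (t + 1) x =
        ∑ k, l k • ∑ x ∈ S.filter (fun x => x ∈ L), (Q k).w x • ξ k (t + 1) x := by
      have hk : ∀ k, ∑ x ∈ S.filter (fun x => x ∈ L), (Q k).w x • ξ k (t + 1) x =
          ∑ x ∈ S.filter (fun x => x ∈ L), R.w x •
            ((Q k).meas (level ψ (t + 1) x) / R.meas (level ψ (t + 1) x)) • ξ k (t + 1) x :=
        fun k => (sum_smul_redistribute _ (fun a b => b ∈ level ψ (t + 1) a)
          (fun a b h => mem_level_comm.1 h) _ _ _ _ _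
          (fun a ha => by rw [R.meas_eq hRS, hfilter a ha])
          (fun a ha => by rw [(Q k).meas_eq (hQS k), hfilter a ha])
          (fun a b h => by rw [level_eq_of_mem h])
          (fun a b h => (eq_of_measurable_filt ((hsol k).1 (t + 1) ht).1 h).symm)
          (fun a _ h => (R.meas_pos (hQR k ((Q k).mem_supp_of_ne_zero h))
            (mem_level_self ψ (t + 1) a)).ne')).symm
      simp_rw [hk, Finset.smul_sum]
      rw [Finset.sum_comm]
      refine Finset.sum_congr rfl fun x _ => ?_
      by_cases h : R.w x = 0
      · simp [h]
      · have hx := (R.meas_pos (R.mem_supp_of_ne_zero h) (mem_level_self ψ (t + 1) x)).ne'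
        simp only [hζ, if_neg hx, Finset.smul_sum, smul_smul]
        refine Finset.sum_congr rfl fun k _ => ?_
        congr 1
        ring
    have hcond : ∀ (P : FinProb Ω), P.supp ⊆ S → ∀ f : Ω → (Fin d → ℝ),
        condExp ψ t P f ω = (P.meas L)⁻¹ • ∑ x ∈ S.filter (fun x => x ∈ L), P.w x • f x :=
      fun P hP f => by
        rw [← P.sum_filter_supp hP]
        unfold condExp
        congr!
    have hfinal : condExp ψ t R (ζ (t + 1)) ω - ζ t ω =
        ∑ k, (l k * ((Q k).meas L / R.meas L)) •
          (condExp ψ t (Q k) (ξ k (t + 1)) ω - ξ k t ω) := by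
      have hζω : ζ t ω = ∑ k, (l k * ((Q k).meas L / R.meas L)) • ξ k t ω := if_neg hpos
      simp only [hζω, smul_sub, Finset.sum_sub_distrib]
      congr 1
      rw [hcond R hRS, hsum, Finset.smul_sum]
      refine Finset.sum_congr rfl fun k _ => ?_
      rw [hcond (Q k) (hQS k), smul_smul, smul_smul]
      by_cases h : (Q k).meas L = 0
      · have hzero : ∀ x ∈ S.filter (fun x => x ∈ L), (Q k).w x • ξ k (t + 1) x = 0 := by
          intro x hx
          by_contra hne
          have hw : (Q k).w x ≠ 0 := fun h0 => hne (by rw [h0, zero_smul])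
          exact ((Q k).meas_pos ((Q k).mem_supp_of_ne_zero hw) (Finset.mem_filter.1 hx).2).ne' h
        rw [Finset.sum_eq_zero hzero, smul_zero, smul_zero]
      · congr 1
        field_simp
    rw [hfinal]
    have hC := (hMSP t (Nat.le_of_succ_le ht))
    have hterm : ∀ k, (Q k).meas L ≠ 0 →
        condExp ψ t (Q k) (ξ k (t + 1)) ω - ξ k t ω ∈ C t ω := fun k hk => by
      obtain ⟨x, hx, hxL⟩ := (Q k).exists_mem_of_meas_ne_zero hk
      have hmem := (hsol k).2 t ht x hx
      have hCx : C t x = C t ω := by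
        rw [← (hC.2.2 x).2.2.1.closure_eq, ← (hC.2.2 ω).2.2.1.closure_eq]
        exact hC.2.1.closure_eq hxL
      have hE : condExp ψ t (Q k) (ξ k (t + 1)) x = condExp ψ t (Q k) (ξ k (t + 1)) ω := by
        unfold condExp
        rw [level_eq_of_mem hxL]
      rwa [hCx, hE, eq_of_measurable_filt ((hsol k).1 t (Nat.le_of_succ_le ht)).1 hxL] at hmem
    have hfilt : ∀ k ∈ Finset.univ, k ∉ Finset.univ.filter (fun k => (Q k).meas L ≠ 0) →
        (Q k).meas L = 0 := fun k _ hk => by simpa using hk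
    rw [← Finset.sum_subset (Finset.filter_subset (fun k => (Q k).meas L ≠ 0) _)
      fun k hk hk' => by rw [hfilt k hk hk', zero_div, mul_zero, zero_smul]]
    refine (hC.2.2 ω).2.2.2.sum_mem (fun k _ => hwt0 k L) ?_
      fun k hk => hterm k (Finset.mem_filter.1 hk).2
    rw [← hwt1 L hpos]
    exact Finset.sum_subset (Finset.filter_subset _ _)
      fun k hk hk' => by rw [hfilt k hk hk', zero_div, mul_zero]

end MSPPaper
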